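/- Let μ be a measure as in the context with μ(ℝ) = ∞, and let f be of bistable type with ∫₀¹ f(s) ds > 0. Then there exist ε₀ ∈ (0,1] and c̲ > 0 such that for every ε ∈ (0, ε₀] and every pair (c, u) with c > 0 and u ∈ C²(ℝ) bounded, monotone nonincreasing, satisfying −c u'(x) = ∫_{|z| ≥ ε} (u(x+z) − u(x)) dμ(z) + f(u(x)) for every x ∈ ℝ, lim_{x→−∞} u(x) = 1 and lim_{x→+∞} u(x) = 0, one has c > c̲. -/

import Mathlib

open MeasureTheory Filter Topology Set

/-- Truncated nonlocal operator `D_{μ,δ} u (x) = ∫_{|z| ≥ δ} (u(x+z) − u(x)) dμ(z)`. -/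
noncomputable def Dtrunc (μ : Measure ℝ) (u : ℝ → ℝ) (δ : ℝ) (x : ℝ) : ℝ :=
  ∫ z in {z : ℝ | δ ≤ |z|}, (u (x + z) - u x) ∂μ

/-- The principal value `D_μ u (x)` exists and equals `L`. -/
def HasPV (μ : Measure ℝ) (u : ℝ → ℝ) (x : ℝ) (L : ℝ) : Prop :=
  Tendsto (fun δ => Dtrunc μ u δ x) (𝓝[>] (0 : ℝ)) (𝓝 L)

/-- A symmetric diffuse Lévy measure as in the paper. -/
structure LevyMeasure (μ : Measure ℝ) : Prop where
  symm : Measure.map (fun z : ℝ => -z) μ = μ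
  moment : ∫⁻ z, ENNReal.ofReal (min 1 (z ^ 2)) ∂μ < ⊤
  diffuse : ∀ x : ℝ, x ≠ 0 → μ {x} = 0

/-- A bistable nonlinearity with threshold `θ`. -/
structure Bistable (f : ℝ → ℝ) (θ : ℝ) : Prop where
  smooth : ContDiff ℝ 1 f
  f0 : f 0 = 0
  f1 : f 1 = 0
  df1 : deriv f 1 < 0
  θ_mem : θ ∈ Set.Ioo (0 : ℝ) 1
  df0 : deriv f 0 < 0
  neg : ∀ s ∈ Set.Ioo (0 : ℝ) θ, f s < 0
  fθ : f θ = 0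
  pos : ∀ s ∈ Set.Ioo θ (1 : ℝ), 0 < f s
  dfθ : 0 < deriv f θ

/-- An ignition nonlinearity with threshold `θ`. -/
structure Ignition (f : ℝ → ℝ) (θ : ℝ) : Prop where
  smooth : ContDiff ℝ 1 f
  f1 : f 1 = 0
  df1 : deriv f 1 < 0
  θ_mem : θ ∈ Set.Ioo (0 : ℝ) 1
  zero : ∀ s ∈ Set.Icc (0 : ℝ) θ, f s = 0
  pos : ∀ s ∈ Set.Ioo θ (1 : ℝ), 0 < f s

/-- A monostable nonlinearity. -/
structure Monostable (f : ℝ → ℝ) : Prop where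
  smooth : ContDiff ℝ 1 f
  f0 : f 0 = 0
  f1 : f 1 = 0
  df1 : deriv f 1 < 0
  pos : ∀ s ∈ Set.Ioo (0 : ℝ) 1, 0 < f s



/-- Travelling wave for the finite measure `ν`. -/
structure Wave (ν : Measure ℝ) (f : ℝ → ℝ) (c : ℝ) (u : ℝ → ℝ) : Prop where
  cpos : 0 < c
  smooth : ContDiff ℝ 2 u
  anti : Antitone u
  eqn : ∀ x, -c * deriv u x = (∫ z, (u (x + z) - u x) ∂ν) + f (u x)
  bot : Tendsto u atBot (𝓝 (1 : ℝ))
  top : Tendsto u atTop (𝓝 (0 : ℝ))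

namespace Wave

variable {ν : Measure ℝ} {f : ℝ → ℝ} {c : ℝ} {u : ℝ → ℝ}

lemma cont (W : Wave ν f c u) : Continuous u := W.smooth.continuous

lemma hd (W : Wave ν f c u) (x : ℝ) : HasDerivAt u (deriv u x) x :=
  (W.smooth.differentiable (by norm_num) x).hasDerivAt

lemma dcont (W : Wave ν f c u) : Continuous (deriv u) :=
  W.smooth.continuous_deriv (by norm_num)

lemma dnonpos (W : Wave ν f c u) (x : ℝ) : deriv u x ≤ 0 := W.anti.deriv_nonpos

lemma nonneg (W : Wave ν f c u) (x : ℝ) : 0 ≤ u x := W.anti.le_of_tendsto W.top x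

lemma le_one (W : Wave ν f c u) (x : ℝ) : u x ≤ 1 := W.anti.ge_of_tendsto W.bot x

lemma dint (W : Wave ν f c u) : Integrable (deriv u) := by
  have h1 : IntegrableOn (deriv u) (Ioi 0) :=
    integrableOn_Ioi_deriv_of_nonpos' (fun x _ => W.hd x) (fun x _ => W.dnonpos x) W.top
  have h2 : IntegrableOn (deriv u) (Iic 0) := by
    have h3 : IntegrableOn (fun x => deriv u (-x)) (Ioi 0) := by
      have := integrableOn_Ioi_deriv_of_nonneg' (a := 0) (g := fun x => u (-x))
        (g' := fun x => - deriv u (-x)) (l := 1)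
        (fun x _ => by
          have := (W.hd (-x)).comp x (hasDerivAt_neg x)
          simpa [Function.comp_def] using this)
        (fun x _ => by have := W.dnonpos (-x); linarith)
        (W.bot.comp tendsto_neg_atTop_atBot)
      simpa using this.neg
    have : IntegrableOn (fun x => deriv u (-x)) (Ici (-0)) := by
      rw [neg_zero]; exact (integrableOn_Ici_iff_integrableOn_Ioi).2 h3
    have h4 := this.comp_neg_Iic
    simpa using h4
  have := h2.union h1
  rwa [Iic_union_Ioi, integrableOn_univ] at this

/-- the (positive) slope -/
lemma wint (W : Wave ν f c u) : Integrable (fun x => - deriv u x) := W.dint.neg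

lemma wint_shift (W : Wave ν f c u) (a : ℝ) : Integrable (fun x => - deriv u (x + a)) :=
  W.wint.comp_add_right a

lemma bdd (W : Wave ν f c u) (x : ℝ) : ‖u x‖ ≤ 1 := by
  rw [Real.norm_eq_abs, abs_of_nonneg (W.nonneg x)]; exact W.le_one x

lemma integral_w (W : Wave ν f c u) : ∫ x, - deriv u x = 1 := by
  rw [integral_neg, integral_of_hasDerivAt_of_tendsto W.hd W.dint W.bot W.top]; norm_num

lemma integral_comp (W : Wave ν f c u) {F : ℝ → ℝ} (hF : Continuous F) :
    Integrable (fun x => F (u x) * (- deriv u x)) ∧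
    ∫ x, F (u x) * (- deriv u x) = ∫ s in (0:ℝ)..1, F s := by
  obtain ⟨C, hC⟩ := (isCompact_Icc (a := (0:ℝ)) (b := 1)).exists_bound_of_continuousOn
    hF.continuousOn
  have hi : Integrable (fun x => F (u x) * (- deriv u x)) :=
    W.wint.bdd_mul (c := C) (hF.comp W.cont).aestronglyMeasurable
      (ae_of_all _ fun x => hC _ ⟨W.nonneg x, W.le_one x⟩)
  refine ⟨hi, ?_⟩
  have hΦ : ∀ s, HasDerivAt (fun s => ∫ t in (0:ℝ)..s, F t) (F s) s := fun s =>
    intervalIntegral.integral_hasDerivAt_right (hF.intervalIntegrable _ _)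
      hF.stronglyMeasurable.stronglyMeasurableAtFilter hF.continuousAt
  have hc : Continuous (fun s => ∫ t in (0:ℝ)..s, F t) :=
    continuous_iff_continuousAt.2 fun s => (hΦ s).continuousAt
  have := integral_of_hasDerivAt_of_tendsto (f := fun x => ∫ t in (0:ℝ)..(u x), F t)
    (f' := fun x => F (u x) * deriv u x)
    (fun x => (hΦ (u x)).comp x (W.hd x)) (by simpa using hi.neg)
    ((hc.tendsto 1).comp W.bot) ((hc.tendsto 0).comp W.top)
  simp only [mul_neg, integral_neg, this]
  simp

lemma int_shift (W : Wave ν f c u) (a b : ℝ) :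
    Integrable (fun x => u (x + a) * (- deriv u (x + b))) :=
  (W.wint_shift b).bdd_mul (c := 1)
    (W.cont.comp (continuous_id.add continuous_const)).aestronglyMeasurable
    (ae_of_all _ fun _ => W.bdd _)

lemma S_shift (_W : Wave ν f c u) (a b : ℝ) :
    ∫ x, u (x + a) * (- deriv u (x + b)) = ∫ x, u (x + (a - b)) * (- deriv u x) := by
  rw [← integral_add_right_eq_self (fun x => u (x + (a - b)) * (- deriv u x)) b]
  congr 1; ext x; congr 2; ring

lemma S_symm (W : Wave ν f c u) (a : ℝ) :
    (∫ x, u (x + a) * (- deriv u x)) + ∫ x, u (x + -a) * (- deriv u x) = 1 := by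
  have h0 : ∀ x, HasDerivAt (fun x => u (x + a) * u x)
      (deriv u (x + a) * u x + u (x + a) * deriv u x) x := fun x =>
    ((W.hd (x + a)).comp_add_const x a).mul (W.hd x)
  have i1 := W.int_shift 0 a
  have i2 := W.int_shift a 0
  simp only [add_zero] at i1 i2
  have hi : Integrable (fun x => deriv u (x + a) * u x + u (x + a) * deriv u x) := by
    have := (i1.add i2).neg
    refine this.congr (ae_of_all _ fun x => ?_)
    simp only [Pi.neg_apply, Pi.add_apply]; ring
  have t1 : Tendsto (fun x => u (x + a) * u x) atBot (𝓝 (1 * 1)) :=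
    (W.bot.comp (tendsto_atBot_add_const_right _ a tendsto_id)).mul W.bot
  have t2 : Tendsto (fun x => u (x + a) * u x) atTop (𝓝 (0 * 0)) :=
    (W.top.comp (tendsto_atTop_add_const_right _ a tendsto_id)).mul W.top
  have := integral_of_hasDerivAt_of_tendsto h0 hi t1 t2
  have e := W.S_shift 0 a
  simp only [add_zero, zero_sub] at e
  rw [← e, ← integral_add i2 i1]
  have : ∫ x, (u (x + a) * (- deriv u x) + u x * (- deriv u (x + a))) =
      - ∫ x, (deriv u (x + a) * u x + u (x + a) * deriv u x) := by
    rw [← integral_neg]; congr 1; ext x; ring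
  rw [this]; linarith

lemma Dint (W : Wave ν f c u) [IsFiniteMeasure ν] (x : ℝ) : Integrable (fun z => u (x + z)) ν :=
  Integrable.of_bound (W.cont.comp (continuous_const.add continuous_id)).aestronglyMeasurable 1
    (ae_of_all _ fun _ => W.bdd _)

lemma test (W : Wave ν f c u) [IsFiniteMeasure ν] (hs : Measure.map (fun z : ℝ => -z) ν = ν)
    (h : ℝ) :
    ∫ x, (∫ z, (u (x + z) - u x) ∂ν) * (- deriv u (x + h) + - deriv u (x + -h)) = 0 := by
  simp_rw [← integral_mul_const]
  have hw : Integrable (fun x => - deriv u (x + h) + - deriv u (x + -h)) :=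
    (W.wint_shift h).add (W.wint_shift (-h))
  have hi : Integrable (Function.uncurry fun x z : ℝ =>
      (u (x + z) - u x) * (- deriv u (x + h) + - deriv u (x + -h))) (volume.prod ν) := by
    have h1 : Integrable (fun p : ℝ × ℝ => (- deriv u (p.1 + h) + - deriv u (p.1 + -h)) * (1:ℝ))
      (volume.prod ν) := hw.mul_prod (integrable_const (1:ℝ))
    simp only [mul_one] at h1
    refine h1.bdd_mul (c := 2) ?_ (ae_of_all _ fun p => ?_)
    · exact ((W.cont.comp (continuous_fst.add continuous_snd)).sub
        (W.cont.comp continuous_fst)).aestronglyMeasurable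
    · have := norm_sub_le (u (p.1 + p.2)) (u p.1)
      have := W.bdd (p.1 + p.2)
      have := W.bdd p.1
      linarith
  rw [integral_integral_swap hi]
  set S : ℝ → ℝ := fun a => ∫ x, u (x + a) * (- deriv u x) with hS
  have hφ : ∀ z, ∫ x, (u (x + z) - u x) * (- deriv u (x + h) + - deriv u (x + -h)) =
      S (z - h) + S (z + h) - 1 := by
    intro z
    have e1 := W.S_shift z h
    have e2 := W.S_shift z (-h)
    have e3 := W.S_shift 0 h
    have e4 := W.S_shift 0 (-h)
    have e5 := W.S_symm h
    have j1 := W.int_shift z h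
    have j2 := W.int_shift z (-h)
    have j3 := W.int_shift 0 h
    have j4 := W.int_shift 0 (-h)
    simp only [add_zero, zero_add, zero_sub, sub_neg_eq_add] at e1 e2 e3 e4 j3 j4
    have j12 : Integrable (fun x => u (x + z) * (- deriv u (x + h)) +
      u (x + z) * (- deriv u (x + -h))) := j1.add j2
    have j34 : Integrable (fun x => u x * (- deriv u (x + h)) +
      u x * (- deriv u (x + -h))) := j3.add j4
    calc _ = ∫ x, ((u (x + z) * (- deriv u (x + h)) + u (x + z) * (- deriv u (x + -h)))
          - (u x * (- deriv u (x + h)) + u x * (- deriv u (x + -h)))) := by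
            congr 1; ext x; ring
      _ = _ := by
        rw [integral_sub j12 j34, integral_add j1 j2, integral_add j3 j4,
          e1, e2, e3, e4]
        simp only [hS]; linarith
  simp_rw [hφ]
  have hodd : ∫ z, (S (-z - h) + S (-z + h) - 1) ∂ν = ∫ z, (S (z - h) + S (z + h) - 1) ∂ν := by
    conv_rhs => rw [← hs]
    exact ((Homeomorph.neg ℝ).measurableEmbedding.integral_map (μ := ν)
      (fun z => S (z - h) + S (z + h) - 1)).symm
  have : ∀ z, (S (-z - h) + S (-z + h) - 1) = - (S (z - h) + S (z + h) - 1) := by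
    intro z
    have a1 := W.S_symm (z - h)
    have a2 := W.S_symm (z + h)
    rw [show -(z - h) = -z + h by ring] at a1
    rw [show -(z + h) = -z - h by ring] at a2
    simp only [hS]; linarith
  simp_rw [this, integral_neg] at hodd
  linarith

end Wave

namespace Wave

variable {ν : Measure ℝ} {f : ℝ → ℝ} {c : ℝ} {u : ℝ → ℝ}

lemma Dint' (W : Wave ν f c u) (ν₀ : Measure ℝ) [IsFiniteMeasure ν₀] (x : ℝ) :
    Integrable (fun z => u (x + z)) ν₀ :=
  Integrable.of_bound (W.cont.comp (continuous_const.add continuous_id)).aestronglyMeasurable 1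
    (ae_of_all _ fun _ => W.bdd _)

lemma drop_eq (W : Wave ν f c u) {a b : ℝ} (hab : a ≤ b) :
    ENNReal.ofReal (u a - u b) = ∫⁻ y in Ioc a b, ENNReal.ofReal (- deriv u y) := by
  have h1 : ∫ y in a..b, deriv u y = u b - u a :=
    intervalIntegral.integral_eq_sub_of_hasDerivAt (fun x _ => W.hd x)
      (W.dcont.intervalIntegrable _ _)
  rw [← ofReal_integral_eq_lintegral_ofReal W.wint.integrableOn
    (ae_of_all _ fun y => by have := W.dnonpos y; simp only [Pi.zero_apply]; linarith)]
  rw [integral_neg, ← intervalIntegral.integral_of_le hab, h1]; congr 1; ring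

lemma conc (W : Wave ν f c u) (ν₀ : Measure ℝ) [IsFiniteMeasure ν₀] {h Q : ℝ} (hh : 0 ≤ h)
    (hQ0 : 0 ≤ Q) (hQ : ∀ t, ν₀ (Icc t (t + h)) ≤ ENNReal.ofReal Q) (x : ℝ) :
    ∫ z, (u (x + z) - u (x + h + z)) ∂ν₀ ≤ Q := by
  have hnn : ∀ z, 0 ≤ u (x + z) - u (x + h + z) := fun z =>
    sub_nonneg.2 (W.anti (by linarith))
  rw [integral_eq_lintegral_of_nonneg_ae (ae_of_all _ hnn)
    ((W.Dint' ν₀ x).sub (W.Dint' ν₀ (x + h))).aestronglyMeasurable]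
  refine ENNReal.toReal_le_of_le_ofReal hQ0 ?_
  let A : Set (ℝ × ℝ) := {p | x + p.1 < p.2 ∧ p.2 ≤ x + h + p.1}
  have hA : MeasurableSet A :=
    MeasurableSet.inter (s₁ := {p : ℝ × ℝ | x + p.1 < p.2})
      (s₂ := {p : ℝ × ℝ | p.2 ≤ x + h + p.1})
      (measurableSet_lt (by fun_prop) (by fun_prop))
      (measurableSet_le (by fun_prop) (by fun_prop))
  have hm : Measurable (fun p : ℝ × ℝ => A.indicator (fun p => ENNReal.ofReal (- deriv u p.2)) p) :=
    Measurable.indicator ((W.dcont.measurable.comp measurable_snd).neg.ennreal_ofReal) hA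
  calc ∫⁻ z, ENNReal.ofReal (u (x + z) - u (x + h + z)) ∂ν₀
      = ∫⁻ z, ∫⁻ y, A.indicator (fun p => ENNReal.ofReal (- deriv u p.2)) (z, y) ∂volume ∂ν₀ := by
        refine lintegral_congr fun z => ?_
        rw [W.drop_eq (by linarith), ← lintegral_indicator measurableSet_Ioc]
        rfl
    _ = ∫⁻ y, ∫⁻ z, A.indicator (fun p => ENNReal.ofReal (- deriv u p.2)) (z, y) ∂ν₀ :=
        lintegral_lintegral_swap hm.aemeasurable
    _ ≤ ∫⁻ y, ENNReal.ofReal (- deriv u y) * ENNReal.ofReal Q := by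
        refine lintegral_mono fun y => ?_
        calc ∫⁻ z, A.indicator (fun p => ENNReal.ofReal (- deriv u p.2)) (z, y) ∂ν₀
            ≤ ∫⁻ z, (Icc (y - x - h) (y - x - h + h)).indicator
                (fun _ => ENNReal.ofReal (- deriv u y)) z ∂ν₀ := by
              refine lintegral_mono fun z => ?_
              by_cases hz : (z, y) ∈ A
              · rw [indicator_of_mem hz, indicator_of_mem]
                obtain ⟨h1, h2⟩ := hz
                simp only at h1 h2
                constructor <;> linarith
              · rw [indicator_of_notMem hz]; exact zero_le
          _ = ENNReal.ofReal (- deriv u y) * ν₀ (Icc (y - x - h) (y - x - h + h)) := by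
              rw [lintegral_indicator measurableSet_Icc, setLIntegral_const]
          _ ≤ _ := by gcongr; exact hQ _
    _ = ENNReal.ofReal Q := by
        have hmw : Measurable (fun y => ENNReal.ofReal (- deriv u y)) :=
          W.dcont.measurable.neg.ennreal_ofReal
        rw [lintegral_mul_const _ hmw,
          ← ofReal_integral_eq_lintegral_ofReal W.wint
          (ae_of_all _ fun y => by have := W.dnonpos y; simp only [Pi.zero_apply]; linarith),
          W.integral_w]
        simp

lemma Dsplit (W : Wave ν f c u) [IsFiniteMeasure ν] (x : ℝ) :
    ∫ z, (u (x + z) - u x) ∂ν = (∫ z, u (x + z) ∂ν) - ν.real univ * u x := by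
  rw [integral_sub (W.Dint x) (integrable_const _), integral_const, smul_eq_mul]

lemma modulus (W : Wave ν f c u) [IsFiniteMeasure ν] (ν₀ : Measure ℝ) [IsFiniteMeasure ν₀]
    (hle : ν₀ ≤ ν) {h Q K : ℝ} (hh : 0 ≤ h)
    (hQ0 : 0 ≤ Q) (hQ : ∀ t, ν₀ (Icc t (t + h)) ≤ ENNReal.ofReal Q)
    (hK : ∀ s ∈ Icc (0:ℝ) 1, ∀ t ∈ Icc (0:ℝ) 1, |f s - f t| ≤ K * |s - t|)
    (hKm : K < ν₀.real univ) (x : ℝ) :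
    (ν₀.real univ - K) * (u x - u (x + h)) ≤ Q := by
  let d : ℝ → ℝ := fun x => u x - u (x + h)
  have hdc : Continuous d := W.cont.sub (W.cont.comp (continuous_id.add continuous_const))
  have hd0 : ∀ x, 0 ≤ d x := fun x => sub_nonneg.2 (W.anti (by linarith))
  have hmax : ∃ a, ∀ y, d y ≤ d a := by
    by_cases hx : ∃ x₀, 0 < d x₀
    · obtain ⟨x₀, hx₀⟩ := hx
      refine hdc.exists_forall_ge' x₀ ?_
      rw [cocompact_eq_atBot_atTop, eventually_sup]
      have t1 : Tendsto d atBot (𝓝 (1 - 1)) :=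
        W.bot.sub (W.bot.comp (tendsto_atBot_add_const_right _ h tendsto_id))
      have t2 : Tendsto d atTop (𝓝 (0 - 0)) :=
        W.top.sub (W.top.comp (tendsto_atTop_add_const_right _ h tendsto_id))
      rw [sub_self] at t1 t2
      exact ⟨(t1.eventually_lt_const hx₀).mono fun _ => le_of_lt,
        (t2.eventually_lt_const hx₀).mono fun _ => le_of_lt⟩
    · push Not at hx
      exact ⟨0, fun y => (hx y).trans (hd0 0)⟩
  obtain ⟨a, ha⟩ := hmax
  have hda : HasDerivAt d (deriv u a - deriv u (a + h)) a :=
    (W.hd a).sub ((W.hd (a + h)).comp_add_const a h)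
  have hz : deriv u a - deriv u (a + h) = 0 :=
    IsLocalMax.hasDerivAt_eq_zero (Eventually.of_forall ha) hda
  have e1 := W.eqn a
  have e2 := W.eqn (a + h)
  rw [W.Dsplit] at e1 e2
  have hz' : deriv u a = deriv u (a + h) := by linarith
  rw [hz'] at e1
  have hf := hK (u a) ⟨W.nonneg _, W.le_one _⟩ (u (a + h)) ⟨W.nonneg _, W.le_one _⟩
  rw [abs_of_nonneg (hd0 a)] at hf
  have hf' := (le_abs_self _).trans hf
  have hi : ∀ (ν' : Measure ℝ) [IsFiniteMeasure ν'],
      Integrable (fun z => d a - (u (a + z) - u (a + h + z))) ν' := fun ν' _ =>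
    (integrable_const _).sub ((W.Dint' ν' a).sub (W.Dint' ν' (a + h)))
  have hI : ∀ (ν' : Measure ℝ) [IsFiniteMeasure ν'],
      ∫ z, (d a - (u (a + z) - u (a + h + z))) ∂ν' =
        ν'.real univ * d a - ∫ z, (u (a + z) - u (a + h + z)) ∂ν' := fun ν' _ => by
    have hsub : Integrable (fun z => u (a + z) - u (a + h + z)) ν' :=
      (W.Dint' ν' a).sub (W.Dint' ν' (a + h))
    rw [integral_sub (integrable_const _) hsub,
      integral_const, smul_eq_mul]
  have hmono : ∫ z, (d a - (u (a + z) - u (a + h + z))) ∂ν₀ ≤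
      ∫ z, (d a - (u (a + z) - u (a + h + z))) ∂ν := by
    refine integral_mono_measure hle (ae_of_all _ fun z => ?_) (hi ν)
    have := ha (a + z)
    simp only [d] at this ⊢
    rw [show a + z + h = a + h + z by ring] at this
    simp only [Pi.zero_apply]; linarith
  rw [hI, hI, integral_sub (W.Dint' ν a) (W.Dint' ν (a + h))] at hmono
  have hc := W.conc ν₀ hh hQ0 hQ a
  have h5 : (ν₀.real univ - K) * d a ≤ Q := by
    simp only [d] at hmono ⊢
    nlinarith
  exact (mul_le_mul_of_nonneg_left (ha x) (by linarith)).trans h5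

lemma slope_bdd (W : Wave ν f c u) [IsFiniteMeasure ν] (hf : Continuous f) :
    ∃ B, ∀ x, ‖- deriv u x‖ ≤ B := by
  obtain ⟨C, hC⟩ := (isCompact_Icc (a := (0:ℝ)) (b := 1)).exists_bound_of_continuousOn
    hf.continuousOn
  refine ⟨(2 * ν.real univ + C) / c, fun x => ?_⟩
  have h1 := hC (u x) ⟨W.nonneg x, W.le_one x⟩
  have h2 : ‖∫ z, (u (x + z) - u x) ∂ν‖ ≤ 2 * ν.real univ :=
    norm_integral_le_of_norm_le_const (ae_of_all _ fun z => by
      have := norm_sub_le (u (x + z)) (u x)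
      have := W.bdd (x + z)
      have := W.bdd x
      linarith)
  rw [le_div_iff₀ W.cpos]
  calc ‖- deriv u x‖ * c = ‖- c * deriv u x‖ := by
        rw [norm_mul, norm_neg, norm_neg, Real.norm_of_nonneg W.cpos.le, mul_comm]
    _ ≤ _ := by rw [W.eqn x]; exact (norm_add_le _ _).trans (add_le_add h2 h1)

lemma test' (W : Wave ν f c u) [IsFiniteMeasure ν] (hs : Measure.map (fun z : ℝ => -z) ν = ν)
    (hf : Continuous f) (s : ℝ) :
    (∫ x, f (u x) * (- deriv u (x + s))) + ∫ x, f (u x) * (- deriv u (x + -s)) =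
      2 * c * ∫ x, (- deriv u x) * (- deriv u (x + s)) := by
  have h0 := W.test hs s
  obtain ⟨B, hB⟩ := W.slope_bdd hf
  obtain ⟨C, hC⟩ := (isCompact_Icc (a := (0:ℝ)) (b := 1)).exists_bound_of_continuousOn
    hf.continuousOn
  have i1 : ∀ s, Integrable (fun x => f (u x) * (- deriv u (x + s))) := fun s =>
    (W.wint_shift s).bdd_mul (c := C) (hf.comp W.cont).aestronglyMeasurable
      (ae_of_all _ fun x => hC _ ⟨W.nonneg x, W.le_one x⟩)
  have i2 : ∀ s, Integrable (fun x => (- deriv u x) * (- deriv u (x + s))) := fun s =>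
    (W.wint_shift s).bdd_mul (c := B) W.dcont.neg.aestronglyMeasurable (ae_of_all _ hB)
  have e : ∫ x, (- deriv u x) * (- deriv u (x + -s)) =
      ∫ x, (- deriv u x) * (- deriv u (x + s)) := by
    rw [← integral_add_right_eq_self (fun x => (- deriv u x) * (- deriv u (x + -s))) s]
    congr 1; ext x; rw [show x + s + -s = x by ring]; ring
  have e2 : ∀ x, (∫ z, (u (x + z) - u x) ∂ν) * (- deriv u (x + s) + - deriv u (x + -s)) =
      (c * ((- deriv u x) * (- deriv u (x + s))) + c * ((- deriv u x) * (- deriv u (x + -s))))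
      - (f (u x) * (- deriv u (x + s)) + f (u x) * (- deriv u (x + -s))) := by
    intro x
    have := W.eqn x
    rw [show ∫ z, (u (x + z) - u x) ∂ν = -c * deriv u x - f (u x) by linarith]
    ring
  simp_rw [e2] at h0
  have j1 : Integrable (fun x => c * ((- deriv u x) * (- deriv u (x + s))) +
    c * ((- deriv u x) * (- deriv u (x + -s)))) := ((i2 s).const_mul c).add ((i2 (-s)).const_mul c)
  have j2 : Integrable (fun x => f (u x) * (- deriv u (x + s)) +
    f (u x) * (- deriv u (x + -s))) := (i1 s).add (i1 (-s))
  rw [integral_sub j1 j2, integral_add (i1 s) (i1 (-s)),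
    integral_add ((i2 s).const_mul c) ((i2 (-s)).const_mul c), integral_const_mul,
    integral_const_mul, e] at h0
  linarith

lemma speed1 (W : Wave ν f c u) [IsFiniteMeasure ν] (hs : Measure.map (fun z : ℝ => -z) ν = ν)
    (hf : Continuous f) {h M K : ℝ} (hh : 0 ≤ h) (hK0 : 0 ≤ K)
    (hK : ∀ s ∈ Icc (0:ℝ) 1, ∀ t ∈ Icc (0:ℝ) 1, |f s - f t| ≤ K * |s - t|)
    (hM : ∀ x, u x - u (x + h) ≤ M) :
    h * ((∫ s in (0:ℝ)..1, f s) - K * M) ≤ c := by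
  set I := ∫ s in (0:ℝ)..1, f s with hI
  obtain ⟨B, hB⟩ := W.slope_bdd hf
  obtain ⟨C, hC⟩ := (isCompact_Icc (a := (0:ℝ)) (b := 1)).exists_bound_of_continuousOn
    hf.continuousOn
  have i1 : ∀ s, Integrable (fun x => f (u x) * (- deriv u (x + s))) := fun s =>
    (W.wint_shift s).bdd_mul (c := C) (hf.comp W.cont).aestronglyMeasurable
      (ae_of_all _ fun x => hC _ ⟨W.nonneg x, W.le_one x⟩)
  have hM' : ∀ x y, |x - y| ≤ h → |u x - u y| ≤ M := by
    have key : ∀ x y, x ≤ y → |x - y| ≤ h → |u x - u y| ≤ M := by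
      intro x y hxy hle
      rw [abs_of_nonneg (sub_nonneg.2 (W.anti hxy))]
      have := (abs_le.1 hle).1
      have := W.anti (show y ≤ x + h by linarith)
      linarith [hM x]
    intro x y hle
    rcases le_total x y with hxy | hxy
    · exact key x y hxy hle
    · rw [abs_sub_comm] at hle ⊢; exact key y x hxy hle
  have low : ∀ s, |s| ≤ h → I - K * M ≤ ∫ x, f (u x) * (- deriv u (x + s)) := by
    intro s hsh
    obtain ⟨g1, g2⟩ := W.integral_comp hf
    have g3 : Integrable (fun x => f (u (x + s)) * (- deriv u (x + s))) := g1.comp_add_right s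
    have g4 : ∫ x, f (u (x + s)) * (- deriv u (x + s)) = I := by
      rw [hI, ← g2]
      exact integral_add_right_eq_self (fun x => f (u x) * (- deriv u x)) s
    have g5 : ∫ x, (- deriv u (x + s)) = 1 := by
      rw [← W.integral_w]
      exact integral_add_right_eq_self (fun x => (- deriv u x)) s
    have g6 : ∫ x, (f (u (x + s)) * (- deriv u (x + s)) - K * M * (- deriv u (x + s))) =
        I - K * M := by
      rw [integral_sub g3 ((W.wint_shift s).const_mul _), g4, integral_const_mul, g5, mul_one]
    rw [← g6]
    refine integral_mono (g3.sub ((W.wint_shift s).const_mul _)) (i1 s) fun x => ?_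
    have q1 := hK (u (x + s)) ⟨W.nonneg _, W.le_one _⟩ (u x) ⟨W.nonneg _, W.le_one _⟩
    have q2 := hM' (x + s) x (by simpa using hsh)
    have q3 := mul_le_mul_of_nonneg_left q2 hK0
    have q4 := le_abs_self (f (u (x + s)) - f (u x))
    have q5 := W.dnonpos (x + s)
    simp only
    nlinarith
  have hR : ∀ s ∈ Icc 0 h, I - K * M ≤ c * ∫ x, (- deriv u x) * (- deriv u (x + s)) := by
    intro s hs'
    have l1 := low s (by rw [abs_of_nonneg hs'.1]; exact hs'.2)
    have l2 := low (-s) (by rw [abs_neg, abs_of_nonneg hs'.1]; exact hs'.2)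
    have := W.test' hs hf s
    linarith
  have hi : Integrable (Function.uncurry fun s x : ℝ => (- deriv u x) * (- deriv u (x + s)))
      ((volume.restrict (uIoc 0 h)).prod volume) := by
    have : IsFiniteMeasure (volume.restrict (uIoc 0 h)) := by
      rw [uIoc_of_le hh]; infer_instance
    have h1 : Integrable (fun p : ℝ × ℝ => (1:ℝ) * (- deriv u p.2))
      ((volume.restrict (uIoc 0 h)).prod volume) := (integrable_const (1:ℝ)).mul_prod W.wint
    simp only [one_mul] at h1
    refine h1.mul_bdd (c := B) ?_ (ae_of_all _ fun p => hB _)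
    exact ((W.dcont.comp (continuous_snd.add continuous_fst)).neg).aestronglyMeasurable
  have hsw := intervalIntegral_integral_swap hi
  have hin : ∀ x, ∫ s in (0:ℝ)..h, (- deriv u x) * (- deriv u (x + s)) =
      (- deriv u x) * (u x - u (x + h)) := by
    intro x
    rw [intervalIntegral.integral_const_mul]
    congr 1
    have : ∀ s, HasDerivAt (fun s => - u (x + s)) (- deriv u (x + s)) s := fun s =>
      ((W.hd (x + s)).comp_const_add x s).neg
    rw [intervalIntegral.integral_eq_sub_of_hasDerivAt (fun s _ => this s)
      ((W.dcont.comp (continuous_const.add continuous_id)).neg.intervalIntegrable _ _)]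
    simp; ring
  simp_rw [hin] at hsw
  have hle1 : ∫ x, (- deriv u x) * (u x - u (x + h)) ≤ 1 := by
    rw [← W.integral_w]
    refine integral_mono_of_nonneg (ae_of_all _ fun x => ?_) W.wint (ae_of_all _ fun x => ?_)
    · exact mul_nonneg (by linarith [W.dnonpos x]) (sub_nonneg.2 (W.anti (by linarith)))
    · have := W.dnonpos x
      have := W.le_one x
      have := W.nonneg (x + h)
      simp only
      nlinarith
  have hii : IntervalIntegrable (fun s => ∫ x, (- deriv u x) * (- deriv u (x + s))) volume 0 h := by
    rw [intervalIntegrable_iff]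
    exact hi.integral_prod_left
  have hfin : ∫ s in (0:ℝ)..h, (I - K * M) ≤
      ∫ s in (0:ℝ)..h, c * ∫ x, (- deriv u x) * (- deriv u (x + s)) :=
    intervalIntegral.integral_mono_on hh (by simp) (hii.const_mul c) hR
  rw [intervalIntegral.integral_const_mul, hsw, intervalIntegral.integral_const, smul_eq_mul,
    sub_zero] at hfin
  nlinarith [W.cpos]

end Wave

/-- Running maximum of `g(t) = m t - f t` on `[0, s]`. -/
noncomputable def runMax (f : ℝ → ℝ) (m s : ℝ) : ℝ :=
  sSup ((fun τ : ℝ => m * (τ * s) - f (τ * s)) '' Icc 0 1)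

lemma runMax_cont {f : ℝ → ℝ} (hf : Continuous f) (m : ℝ) : Continuous (runMax f m) := by
  unfold runMax
  refine isCompact_Icc.continuous_sSup (f := fun s τ : ℝ => m * (τ * s) - f (τ * s)) ?_
  simp only [Function.HasUncurry.uncurry, id]
  fun_prop

lemma le_runMax {f : ℝ → ℝ} (hf : Continuous f) (m : ℝ) {t s : ℝ} (ht : 0 ≤ t) (hts : t ≤ s) :
    m * t - f t ≤ runMax f m s := by
  have hb : BddAbove ((fun τ : ℝ => m * (τ * s) - f (τ * s)) '' Icc 0 1) :=
    (isCompact_Icc.image (by fun_prop)).bddAbove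
  rcases (ht.trans hts).eq_or_lt with hs | hs
  · obtain rfl : t = s := by linarith
    exact le_csSup hb ⟨1, by simp, by simp⟩
  · refine le_csSup hb ⟨t / s, ⟨by positivity, (div_le_one hs).2 hts⟩, ?_⟩
    have : t / s * s = t := by field_simp
    simp only [this]

lemma exists_runMax {f : ℝ → ℝ} (hf : Continuous f) (m : ℝ) {s : ℝ} (hs : 0 ≤ s) :
    ∃ t, 0 ≤ t ∧ t ≤ s ∧ runMax f m s = m * t - f t := by
  obtain ⟨τ, hτ, h⟩ := (isCompact_Icc (a := (0:ℝ)) (b := 1)).exists_sSup_image_eq (by simp)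
    (f := fun τ : ℝ => m * (τ * s) - f (τ * s)) (by fun_prop)
  refine ⟨τ * s, mul_nonneg hτ.1 hs, ?_, h⟩
  nlinarith [hτ.2]

/-- Pinning excess. -/
noncomputable def excess (f : ℝ → ℝ) (m : ℝ) : ℝ := ∫ s in (0:ℝ)..1, (m * s - runMax f m s)

lemma excess_mono {f : ℝ → ℝ} (hf : Continuous f) {m m' : ℝ} (h : m ≤ m') :
    excess f m ≤ excess f m' := by
  unfold excess
  have hc : ∀ m, Continuous (fun s => m * s - runMax f m s) := fun m =>
    (continuous_const.mul continuous_id).sub (runMax_cont hf m)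
  refine intervalIntegral.integral_mono_on (by norm_num) ((hc m).intervalIntegrable _ _)
    ((hc m').intervalIntegrable _ _) fun s hs => ?_
  obtain ⟨t, t0, ts, e⟩ := exists_runMax hf m' hs.1
  have := le_runMax hf m t0 ts
  nlinarith

namespace Wave

variable {ν : Measure ℝ} {f : ℝ → ℝ} {c : ℝ} {u : ℝ → ℝ}

lemma v_eq (W : Wave ν f c u) [IsFiniteMeasure ν] (x : ℝ) :
    ∫ z, u (x + z) ∂ν = ν.real univ * u x - f (u x) + c * (- deriv u x) := by
  have := W.eqn x
  rw [W.Dsplit] at this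
  linarith

lemma v_anti (W : Wave ν f c u) [IsFiniteMeasure ν] :
    Antitone (fun x => ∫ z, u (x + z) ∂ν) := fun x y hxy =>
  integral_mono (W.Dint y) (W.Dint x) fun z => W.anti (by linarith)

lemma exists_val (W : Wave ν f c u) {x t : ℝ} (h0 : 0 < t) (h1 : t ≤ u x) :
    ∃ y, x ≤ y ∧ u y = t := by
  obtain ⟨b, hb⟩ := (W.top.eventually_lt_const h0).exists
  have hxb : x ≤ b := by
    by_contra hlt
    have := W.anti (not_le.1 hlt).le
    linarith
  obtain ⟨y, hy, e⟩ := intermediate_value_Icc' hxb W.cont.continuousOn ⟨hb.le, h1⟩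
  exact ⟨y, hy.1, e⟩

lemma runMax_le_v (W : Wave ν f c u) [IsFiniteMeasure ν] (hf : Continuous f) (f0 : f 0 = 0)
    (x : ℝ) : runMax f (ν.real univ) (u x) ≤ ∫ z, u (x + z) ∂ν := by
  obtain ⟨t, t0, ts, e⟩ := exists_runMax hf (ν.real univ) (W.nonneg x)
  rw [e]
  rcases t0.eq_or_lt with rfl | t0
  · rw [f0]; simp only [mul_zero, sub_zero]
    exact integral_nonneg fun z => W.nonneg _
  · obtain ⟨y, hxy, rfl⟩ := W.exists_val t0 ts
    have h1 := W.v_anti hxy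
    simp only at h1
    have h2 := W.v_eq y
    have := mul_nonneg W.cpos.le (neg_nonneg.2 (W.dnonpos y))
    linarith

lemma v_cont (W : Wave ν f c u) [IsFiniteMeasure ν] (hf : Continuous f) :
    Continuous (fun x => ∫ z, u (x + z) ∂ν) := by
  simp_rw [W.v_eq]
  exact ((continuous_const.mul W.cont).sub (hf.comp W.cont)).add
    (continuous_const.mul W.dcont.neg)

/-- energy identity -/
lemma energy (W : Wave ν f c u) [IsFiniteMeasure ν] (hs : Measure.map (fun z : ℝ => -z) ν = ν)
    (hf : Continuous f) :
    Integrable (fun x => ((∫ z, u (x + z) ∂ν) - runMax f (ν.real univ) (u x)) * (- deriv u x)) ∧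
    ∫ x, ((∫ z, u (x + z) ∂ν) - runMax f (ν.real univ) (u x)) * (- deriv u x) =
      excess f (ν.real univ) := by
  set m := ν.real univ with hm
  have h0 := W.test hs 0
  simp only [neg_zero, add_zero] at h0
  have e1 : ∀ x, (∫ z, (u (x + z) - u x) ∂ν) * (- deriv u x + - deriv u x) =
      2 * (((∫ z, u (x + z) ∂ν) - m * u x) * (- deriv u x)) := by
    intro x; rw [W.Dsplit]; ring
  simp_rw [e1] at h0
  rw [integral_const_mul] at h0
  have hc : Continuous (fun s => m * s - runMax f m s) :=
    (continuous_const.mul continuous_id).sub (runMax_cont hf m)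
  obtain ⟨i1, i2⟩ := W.integral_comp hc
  have i3 : Integrable (fun x => ((∫ z, u (x + z) ∂ν) - m * u x) * (- deriv u x)) := by
    refine W.wint.bdd_mul (c := m + m) ((W.v_cont hf).sub
      (continuous_const.mul W.cont)).aestronglyMeasurable (ae_of_all _ fun x => ?_)
    refine (norm_sub_le _ _).trans (add_le_add ?_ ?_)
    · have := norm_integral_le_of_norm_le_const (μ := ν) (C := 1) (f := fun z => u (x + z))
        (ae_of_all _ fun z => W.bdd _)
      simpa using this
    · rw [norm_mul, Real.norm_of_nonneg (measureReal_nonneg)]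
      have := W.bdd x
      have h2 : 0 ≤ m := measureReal_nonneg
      nlinarith
  have e2 : (fun x => ((∫ z, u (x + z) ∂ν) - runMax f m (u x)) * (- deriv u x)) =
      fun x => ((∫ z, u (x + z) ∂ν) - m * u x) * (- deriv u x) +
        (m * u x - runMax f m (u x)) * (- deriv u x) := by
    ext x; ring
  rw [e2]
  refine ⟨i3.add i1, ?_⟩
  rw [integral_add i3 i1, i2, excess]
  linarith

lemma speed2 (W : Wave ν f c u) [IsFiniteMeasure ν] (hs : Measure.map (fun z : ℝ => -z) ν = ν)
    (hf : Continuous f) {h Q η : ℝ} (hh : 0 < h)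
    (hQ0 : 0 ≤ Q) (hQ : ∀ t, ν (Icc t (t + h)) ≤ ENNReal.ofReal Q) (hc : c ≤ η * h) :
    excess f (ν.real univ) ≤ η + Q := by
  obtain ⟨i1, e1⟩ := W.energy hs hf
  rw [← e1, ← mul_one (η + Q), ← W.integral_w, ← integral_const_mul]
  refine integral_mono i1 (W.wint.const_mul _) fun x => ?_
  refine mul_le_mul_of_nonneg_right ?_ (by linarith [W.dnonpos x])
  obtain ⟨y, hy, ey⟩ := exists_deriv_eq_slope u (show x < x + h by linarith)
    W.cont.continuousOn (fun z _ => (W.hd z).differentiableAt.differentiableWithinAt)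
  have h1 : c * (- deriv u y) ≤ η := by
    rw [ey]
    have a1 := W.le_one x
    have a2 := W.nonneg (x + h)
    have : -((u (x + h) - u x) / (x + h - x)) = (u x - u (x + h)) / h := by
      rw [add_sub_cancel_left, ← neg_div]; congr 1; ring
    rw [this, ← mul_div_assoc, div_le_iff₀ hh]
    nlinarith [W.cpos]
  have h2 := W.v_eq y
  have h3 := le_runMax hf (ν.real univ) (W.nonneg y) (W.anti hy.1.le)
  have h4 := W.v_anti hy.2.le
  have h5 := W.conc ν hh.le hQ0 hQ x
  rw [integral_sub (W.Dint x) (W.Dint (x + h))] at h5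
  simp only at h4
  linarith

lemma strict (W : Wave ν f c u) [IsFiniteMeasure ν] (hs : Measure.map (fun z : ℝ => -z) ν = ν)
    (hf : Continuous f) (f0 : f 0 = 0) {K : ℝ} (hK0 : 0 ≤ K)
    (hK : ∀ s ∈ Icc (0:ℝ) 1, ∀ t ∈ Icc (0:ℝ) 1, |f s - f t| ≤ K * |s - t|)
    {r : ℝ} (hr0 : 0 < r) (hr1 : r < 1) (hr : f r < 0) :
    0 < excess f (ν.real univ) := by
  by_contra hneg
  push Not at hneg
  obtain ⟨i1, e1⟩ := W.energy hs hf
  set m := ν.real univ with hm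
  have hm0 : 0 ≤ m := measureReal_nonneg
  set v : ℝ → ℝ := fun x => ∫ z, u (x + z) ∂ν with hv
  have veq : ∀ x, v x = m * u x - f (u x) + c * (- deriv u x) := W.v_eq
  have vG : ∀ x, runMax f m (u x) ≤ v x := W.runMax_le_v hf f0
  have hGc := runMax_cont hf m
  have hnn : ∀ x, 0 ≤ (v x - runMax f m (u x)) * (- deriv u x) := fun x =>
    mul_nonneg (sub_nonneg.2 (vG x)) (by linarith [W.dnonpos x])
  have hz : ∀ x, (v x - runMax f m (u x)) * (- deriv u x) = 0 := by
    have h1 : ∫ x, (v x - runMax f m (u x)) * (- deriv u x) = 0 :=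
      le_antisymm (e1.trans_le hneg) (integral_nonneg hnn)
    have h2 := (integral_eq_zero_iff_of_nonneg hnn i1).1 h1
    have h3 := Continuous.ae_eq_iff_eq volume
      (((W.v_cont hf).sub (hGc.comp W.cont)).mul W.dcont.neg) continuous_zero |>.1 h2
    exact fun x => congrFun h3 x
  have hvG : ∀ x, v x = runMax f m (u x) := by
    intro x
    rcases mul_eq_zero.1 (hz x) with h | h
    · linarith
    · have := veq x
      rw [h] at this
      have := le_runMax hf m (W.nonneg x) le_rfl
      linarith [vG x]
  -- key increment bound
  have key : ∀ x y, x ≤ y → v x = v y ∨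
      ((∃ ξ ∈ Icc x y, deriv u ξ = 0) ∧ v x - v y ≤ (m + K) * (u x - u y)) := by
    intro x y hxy
    obtain ⟨t, t0, ts, e⟩ := exists_runMax hf m (W.nonneg x)
    by_cases hty : t ≤ u y
    · left
      have h1 := le_runMax hf m t0 hty
      have h2 := W.v_anti hxy
      simp only at h2
      have a1 := hvG x
      have a2 := hvG y
      change v y ≤ v x at h2
      linarith
    · right
      push Not at hty
      obtain ⟨ξ, hξ, rfl⟩ := intermediate_value_Icc' hxy W.cont.continuousOn ⟨hty.le, ts⟩
      constructor
      · refine ⟨ξ, hξ, ?_⟩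
        have h2 : v ξ ≤ v x := W.v_anti hξ.1
        have a1 := hvG x
        have a2 := veq ξ
        have a3 : c * (- deriv u ξ) ≤ 0 := by linarith
        have a4 := W.dnonpos ξ
        nlinarith [W.cpos]
      · have a1 := hvG x
        have a2 := hvG y
        have a3 := le_runMax hf m (W.nonneg y) le_rfl
        have a4 := hK (u y) ⟨W.nonneg _, W.le_one _⟩ (u ξ) ⟨W.nonneg _, W.le_one _⟩
        have a5 := le_abs_self (f (u y) - f (u ξ))
        rw [abs_sub_comm (u y), abs_of_nonneg (sub_nonneg.2 hty.le)] at a4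
        nlinarith
  have hder : ∀ x, HasDerivAt v 0 x := by
    intro x
    by_cases hx : deriv u x = 0
    · have hb : ∀ y, |v y - v x| ≤ (m + K) * |u y - u x| := by
        have : ∀ x y, x ≤ y → |v x - v y| ≤ (m + K) * |u x - u y| := by
          intro x y hxy
          have h2 : v y ≤ v x := W.v_anti hxy
          rw [abs_of_nonneg (sub_nonneg.2 h2), abs_of_nonneg (sub_nonneg.2 (W.anti hxy))]
          rcases key x y hxy with h | h
          · rw [h, sub_self]
            exact mul_nonneg (by linarith) (sub_nonneg.2 (W.anti hxy))
          · exact h.2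
        intro y
        rcases le_total x y with h | h
        · rw [abs_sub_comm, abs_sub_comm (u y)]; exact this x y h
        · exact this y x h
      have hu := W.hd x
      rw [hx, hasDerivAt_iff_isLittleO] at hu
      rw [hasDerivAt_iff_isLittleO]
      simp only [smul_zero, sub_zero] at hu ⊢
      refine Asymptotics.IsBigO.trans_isLittleO ?_ hu
      exact Asymptotics.IsBigO.of_bound (m + K) (Eventually.of_forall hb)
    · have : ∀ᶠ y in 𝓝 x, deriv u y ≠ 0 := W.dcont.continuousAt.eventually_ne hx
      obtain ⟨δ, hδ, hball⟩ := Metric.eventually_nhds_iff_ball.1 this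
      have hloc : v =ᶠ[𝓝 x] fun _ => v x := by
        filter_upwards [Metric.ball_mem_nhds x hδ] with y hy
        have hseg : ∀ a ∈ Metric.ball x δ, ∀ b ∈ Metric.ball x δ, a ≤ b → v a = v b := by
          intro a ha b hb hab
          rcases key a b hab with h | ⟨⟨ξ, hξ, h⟩, _⟩
          · exact h
          · exfalso
            refine hball ξ ?_ h
            rw [Real.ball_eq_Ioo] at ha hb ⊢
            exact ⟨ha.1.trans_le hξ.1, hξ.2.trans_lt hb.2⟩
        rcases le_total x y with h | h
        · exact (hseg x (Metric.mem_ball_self hδ) y hy h).symm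
        · exact hseg y hy x (Metric.mem_ball_self hδ) h
      exact (hasDerivAt_const x (v x)).congr_of_eventuallyEq hloc
  have hconst : ∀ x y, v x = v y :=
    is_const_of_deriv_eq_zero (fun x => (hder x).differentiableAt) (fun x => (hder x).deriv)
  -- limit at infinity
  have hlim : Tendsto v atTop (𝓝 (runMax f m 0)) := by
    have := (hGc.tendsto 0).comp W.top
    refine this.congr fun x => ?_
    simp [hvG]
  have hG0 : runMax f m 0 = 0 := by
    obtain ⟨t, t0, ts, e⟩ := exists_runMax hf m (le_refl (0:ℝ))
    obtain rfl : t = 0 := le_antisymm ts t0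
    rw [e, f0]; ring
  have hv0 : v 0 = 0 := by
    rw [hG0] at hlim
    refine tendsto_nhds_unique ?_ hlim
    exact tendsto_const_nhds.congr fun x => hconst 0 x
  obtain ⟨x, hx⟩ := (W.bot.eventually_const_lt hr1).exists
  have h1 := le_runMax hf m hr0.le hx.le
  rw [← hvG, hconst x 0, hv0] at h1
  have := mul_nonneg hm0 hr0.le
  linarith

end Wave

lemma conc_small (ν : Measure ℝ) [IsFiniteMeasure ν] (hat : ∀ x, ν {x} = 0) {η : ℝ}
    (hη : 0 < η) : ∃ h > 0, ∀ t, ν (Icc t (t + h)) ≤ ENNReal.ofReal η := by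
  have hη' : (0 : ENNReal) < ENNReal.ofReal η := ENNReal.ofReal_pos.2 hη
  -- tails
  have htail : ∃ R : ℝ, ν (Icc (-R) R)ᶜ ≤ ENNReal.ofReal η := by
    have hanti : Antitone (fun n : ℕ => (Icc (-(n:ℝ)) n)ᶜ) := by
      intro n k hnk
      refine compl_subset_compl.2 (Icc_subset_Icc ?_ ?_)
      · have : (n:ℝ) ≤ k := by exact_mod_cast hnk
        linarith
      · exact_mod_cast hnk
    have ht := tendsto_measure_iInter_atTop (μ := ν) (s := fun n : ℕ => (Icc (-(n:ℝ)) n)ᶜ)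
      (fun n => measurableSet_Icc.compl.nullMeasurableSet) hanti ⟨0, measure_ne_top _ _⟩
    have he : ⋂ n : ℕ, (Icc (-(n:ℝ)) n)ᶜ = ∅ := by
      ext x
      simp only [mem_iInter, mem_compl_iff, mem_empty_iff_false, iff_false, not_forall, not_not]
      obtain ⟨n, hn⟩ := exists_nat_ge |x|
      exact ⟨n, abs_le.1 hn⟩
    rw [he, measure_empty] at ht
    obtain ⟨n, hn⟩ := (ht.eventually_lt_const hη').exists
    exact ⟨n, hn.le⟩
  obtain ⟨R, hR⟩ := htail
  have hpt : ∀ x : ℝ, ∃ δ > 0, ν (Metric.ball x δ) ≤ ENNReal.ofReal η := by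
    intro x
    have ht := tendsto_measure_cthickening_of_isCompact (μ := ν) (isCompact_singleton (x := x))
    rw [hat x] at ht
    have h2 := (ht.eventually_lt_const hη')
    obtain ⟨δ, hδ, hb⟩ := Metric.eventually_nhds_iff.1 h2
    refine ⟨δ / 2, by positivity, ?_⟩
    have := hb (y := δ / 2) (by rw [Real.dist_eq, sub_zero, abs_of_pos (by positivity)]; linarith)
    refine (measure_mono ?_).trans this.le
    rw [Metric.cthickening_singleton _ (by positivity)]
    exact Metric.ball_subset_closedBall
  choose δ hδ hball using hpt
  obtain ⟨ρ, hρ, hleb⟩ := lebesgue_number_lemma_of_metric (isCompact_Icc (a := -R) (b := R))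
    (c := fun x : ℝ => Metric.ball x (δ x)) (fun _ => Metric.isOpen_ball)
    (fun x _ => mem_iUnion.2 ⟨x, Metric.mem_ball_self (hδ x)⟩)
  refine ⟨ρ / 2, by positivity, fun t => ?_⟩
  by_cases hm : ∃ x ∈ Icc t (t + ρ / 2), x ∈ Icc (-R) R
  · obtain ⟨x, hx, hxR⟩ := hm
    obtain ⟨i, hi⟩ := hleb x hxR
    refine (measure_mono ?_).trans (hball i)
    refine Subset.trans (fun y hy => ?_) hi
    rw [Real.ball_eq_Ioo]
    constructor <;> linarith [hx.1, hx.2, hy.1, hy.2]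
  · refine (measure_mono fun y hy hyR => hm ⟨y, hy, hyR⟩).trans hR

lemma LevyMeasure.meas_lt_top {μ : Measure ℝ} (hμ : LevyMeasure μ) {ε : ℝ} (hε : 0 < ε) :
    μ {z : ℝ | ε ≤ |z|} < ⊤ := by
  have hp : 0 < min 1 (ε ^ 2) := lt_min one_pos (by positivity)
  have h1 := meas_ge_le_lintegral_div (μ := μ)
    (f := fun z : ℝ => ENNReal.ofReal (min 1 (z ^ 2)))
    (by fun_prop) (ε := ENNReal.ofReal (min 1 (ε ^ 2)))
    (ENNReal.ofReal_pos.2 hp).ne' ENNReal.ofReal_ne_top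
  have h2 := h1.trans_lt (ENNReal.div_lt_top hμ.moment.ne (ENNReal.ofReal_pos.2 hp).ne')
  refine (measure_mono fun z hz => ?_).trans_lt h2
  simp only [mem_ofPred_eq] at hz ⊢
  refine ENNReal.ofReal_le_ofReal (min_le_min le_rfl ?_)
  rw [← sq_abs z]
  exact pow_le_pow_left₀ hε.le hz 2

lemma trunc_meas (ε : ℝ) : MeasurableSet {z : ℝ | ε ≤ |z|} :=
  measurableSet_le measurable_const (by fun_prop)

lemma LevyMeasure.restrict_symm {μ : Measure ℝ} (hμ : LevyMeasure μ) (ε : ℝ) :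
    Measure.map (fun z : ℝ => -z) (μ.restrict {z : ℝ | ε ≤ |z|}) =
      μ.restrict {z : ℝ | ε ≤ |z|} := by
  have h := Measure.restrict_map (μ := μ) (f := fun z : ℝ => -z) measurable_neg (trunc_meas ε)
  rw [hμ.symm] at h
  have hpre : (fun z : ℝ => -z) ⁻¹' {z : ℝ | ε ≤ |z|} = {z : ℝ | ε ≤ |z|} := by
    ext z; simp
  rw [hpre] at h
  exact h.symm

lemma LevyMeasure.atom {μ : Measure ℝ} (hμ : LevyMeasure μ) {S : Set ℝ} (hS : (0:ℝ) ∉ S) (x : ℝ) :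
    μ.restrict S {x} = 0 := by
  rw [Measure.restrict_apply (measurableSet_singleton x)]
  by_cases hx : x = 0
  · subst hx
    rw [singleton_inter_eq_empty.2 hS, measure_empty]
  · exact measure_mono_null inter_subset_left (hμ.diffuse x hx)

lemma lip_bound {f : ℝ → ℝ} (hf : ContDiff ℝ 1 f) : ∃ K, 0 ≤ K ∧
    ∀ s ∈ Icc (0:ℝ) 1, ∀ t ∈ Icc (0:ℝ) 1, |f s - f t| ≤ K * |s - t| := by
  obtain ⟨C, hC⟩ := (isCompact_Icc (a := (0:ℝ)) (b := 1)).exists_bound_of_continuousOn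
    (hf.continuous_deriv le_rfl).continuousOn
  refine ⟨max C 0, le_max_right _ _, fun s hs t ht => ?_⟩
  have := (convex_Icc (0:ℝ) 1).norm_image_sub_le_of_norm_deriv_le (f := f) (C := max C 0)
    (fun x _ => hf.differentiable (by norm_num) x) (fun x hx => (hC x hx).trans (le_max_left _ _))
    ht hs
  simpa using this

/-- uniform positive lower bound on the approximated speeds (Proposition 4.5). -/
theorem approx_speed_lower_bound
    (μ : Measure ℝ) (hμ : LevyMeasure μ) (hinf : μ Set.univ = ⊤)
    (f : ℝ → ℝ) (hf : ∃ θ, Bistable f θ)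
    (hint : 0 < ∫ s in (0:ℝ)..1, f s) :
    ∃ ε₀ ∈ Set.Ioc (0 : ℝ) 1, ∃ cunder : ℝ, 0 < cunder ∧
      ∀ ε ∈ Set.Ioc (0 : ℝ) ε₀,
        ∀ (c : ℝ) (u : ℝ → ℝ), 0 < c → ContDiff ℝ 2 u →
          (∃ M : ℝ, ∀ x, |u x| ≤ M) → Antitone u →
          (∀ x, -c * deriv u x
            = (∫ z in {z : ℝ | ε ≤ |z|}, (u (x + z) - u x) ∂μ) + f (u x)) →
          Tendsto u atBot (𝓝 (1 : ℝ)) → Tendsto u atTop (𝓝 (0 : ℝ)) →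
          cunder < c := by
  obtain ⟨θ, hθ⟩ := hf
  have hfc : Continuous f := hθ.smooth.continuous
  obtain ⟨K, hK0, hK⟩ := lip_bound hθ.smooth
  have hsubset : ∀ {ε ε' : ℝ}, ε ≤ ε' → {z : ℝ | ε' ≤ |z|} ⊆ {z : ℝ | ε ≤ |z|} :=
    fun h z hz => le_trans h hz
  have h0S : ∀ {ε : ℝ}, 0 < ε → (0:ℝ) ∉ {z : ℝ | ε ≤ |z|} := fun hε h => by
    simp only [mem_ofPred_eq, abs_zero] at h; linarith
  have hfin : ∀ {ε : ℝ}, 0 < ε → IsFiniteMeasure (μ.restrict {z : ℝ | ε ≤ |z|}) := fun hε =>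
    ⟨by rw [Measure.restrict_apply_univ]; exact hμ.meas_lt_top hε⟩
  by_cases hcase : μ {(0:ℝ)}ᶜ = ⊤
  · -- infinitely many jumps away from zero
    obtain ⟨n, hn⟩ : ∃ n : ℕ, ENNReal.ofReal K < μ {z : ℝ | 1 / ((n:ℝ) + 1) ≤ |z|} := by
      have hmono : Monotone (fun n : ℕ => {z : ℝ | 1 / ((n:ℝ) + 1) ≤ |z|}) := fun n k hnk =>
        hsubset (one_div_le_one_div_of_le (by positivity)
          (by have : (n:ℝ) ≤ k := by exact_mod_cast hnk
              linarith))
      have ht := tendsto_measure_iUnion_atTop (μ := μ) hmono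
      have hU : ⋃ n : ℕ, {z : ℝ | 1 / ((n:ℝ) + 1) ≤ |z|} = {(0:ℝ)}ᶜ := by
        ext z
        simp only [mem_iUnion, mem_ofPred_eq, mem_compl_iff, mem_singleton_iff]
        constructor
        · rintro ⟨n, hn⟩ rfl
          rw [abs_zero] at hn
          have : 0 < 1 / ((n:ℝ) + 1) := by positivity
          linarith
        · intro hz
          obtain ⟨n, hn⟩ := exists_nat_one_div_lt (abs_pos.2 hz)
          exact ⟨n, hn.le⟩
      rw [hU, hcase] at ht
      exact (ht.eventually_const_lt (ENNReal.ofReal_lt_top)).exists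
    set ε₀ : ℝ := 1 / ((n:ℝ) + 1) with hε₀
    have hε₀pos : 0 < ε₀ := by positivity
    have hε₀le : ε₀ ≤ 1 := by
      rw [hε₀, div_le_one (by positivity)]
      have : (0:ℝ) ≤ n := n.cast_nonneg
      linarith
    set ν₀ := μ.restrict {z : ℝ | ε₀ ≤ |z|} with hν₀
    have : IsFiniteMeasure ν₀ := hfin hε₀pos
    have hKm : K < ν₀.real univ := by
      rw [measureReal_def, hν₀, Measure.restrict_apply_univ]
      exact (ENNReal.ofReal_lt_iff_lt_toReal hK0 (hμ.meas_lt_top hε₀pos).ne).1 hn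
    set I := ∫ s in (0:ℝ)..1, f s with hI
    set Q : ℝ := (ν₀.real univ - K) * (I / (2 * (K + 1))) with hQdef
    have hd : 0 < ν₀.real univ - K := by linarith
    have hQ : 0 < Q := by positivity
    obtain ⟨h, hh, hcon⟩ := conc_small ν₀ (hμ.atom (h0S hε₀pos)) hQ
    refine ⟨ε₀, ⟨hε₀pos, hε₀le⟩, h * I / 4, by positivity, ?_⟩
    intro ε hε c u hc hu _ hanti heq hbot htop
    have : IsFiniteMeasure (μ.restrict {z : ℝ | ε ≤ |z|}) := hfin hε.1
    have W : Wave (μ.restrict {z : ℝ | ε ≤ |z|}) f c u := ⟨hc, hu, hanti, heq, hbot, htop⟩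
    have hM : ∀ x, u x - u (x + h) ≤ I / (2 * (K + 1)) := by
      intro x
      have := W.modulus ν₀ (Measure.restrict_mono (hsubset hε.2) le_rfl) hh.le hQ.le hcon hK hKm x
      rw [hQdef] at this
      exact le_of_mul_le_mul_left this hd
    have := W.speed1 (hμ.restrict_symm ε) hfc hh.le hK0 hK hM
    have h2 : K * (I / (2 * (K + 1))) ≤ I / 2 := by
      rw [← mul_div_assoc, div_le_div_iff₀ (by positivity) (by norm_num)]
      nlinarith
    rw [← hI] at this
    have h3 : h * (I / 2) ≤ h * (I - K * (I / (2 * (K + 1)))) :=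
      mul_le_mul_of_nonneg_left (by linarith) hh.le
    have h4 : 0 < h * I := by positivity
    linarith
  · -- finitely many jumps
    set ν₁ := μ.restrict {(0:ℝ)}ᶜ with hν₁
    have : IsFiniteMeasure ν₁ :=
      ⟨by rw [Measure.restrict_apply_univ]; exact lt_top_iff_ne_top.2 hcase⟩
    by_cases hex : ∃ ε₁ ∈ Ioc (0:ℝ) 1, ∃ c u, Wave (μ.restrict {z : ℝ | ε₁ ≤ |z|}) f c u
    · obtain ⟨ε₁, hε₁, c₁, u₁, W₁⟩ := hex
      have : IsFiniteMeasure (μ.restrict {z : ℝ | ε₁ ≤ |z|}) := hfin hε₁.1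
      have hθm := hθ.θ_mem
      have hE := W₁.strict (hμ.restrict_symm ε₁) hfc hθ.f0 hK0 hK (r := θ / 2)
        (by linarith [hθm.1]) (by linarith [hθm.1, hθm.2])
        (hθ.neg _ ⟨by linarith [hθm.1], by linarith [hθm.1]⟩)
      set E := excess f ((μ.restrict {z : ℝ | ε₁ ≤ |z|}).real univ) with hEdef
      obtain ⟨h, hh, hcon⟩ := conc_small ν₁ (hμ.atom (by simp)) (η := E / 3) (by positivity)
      refine ⟨ε₁, hε₁, E / 3 * h, by positivity, ?_⟩
      intro ε hε c u hc hu _ hanti heq hbot htop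
      have : IsFiniteMeasure (μ.restrict {z : ℝ | ε ≤ |z|}) := hfin hε.1
      have W : Wave (μ.restrict {z : ℝ | ε ≤ |z|}) f c u := ⟨hc, hu, hanti, heq, hbot, htop⟩
      by_contra hlt
      push Not at hlt
      have hsub0 : {z : ℝ | ε ≤ |z|} ⊆ {(0:ℝ)}ᶜ := by
        intro z hz h0
        rw [mem_singleton_iff] at h0
        rw [h0] at hz
        exact h0S hε.1 hz
      have hle1 : μ.restrict {z : ℝ | ε ≤ |z|} ≤ ν₁ := Measure.restrict_mono hsub0 le_rfl
      have h1 := W.speed2 (hμ.restrict_symm ε) hfc hh (Q := E / 3) (by positivity)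
        (fun t => (hle1 _).trans (hcon t)) hlt
      have h2 : E ≤ excess f ((μ.restrict {z : ℝ | ε ≤ |z|}).real univ) := by
        refine excess_mono hfc ?_
        rw [measureReal_def, measureReal_def]
        exact ENNReal.toReal_mono (measure_ne_top _ _)
          (Measure.restrict_mono (hsubset hε.2) le_rfl _)
      linarith
    · refine ⟨1, ⟨one_pos, le_rfl⟩, 1, one_pos, ?_⟩
      intro ε hε c u hc hu _ hanti heq hbot htop
      exact (hex ⟨ε, hε, c, u, hc, hu, hanti, heq, hbot, htop⟩).elim
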